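/- A simplicial tree of bounded valence in which every vertex has degree at least 2 and which contains a vertex of degree at least 3 within uniformly bounded distance of every vertex is quasi-isometric to the trivalent tree (the infinite tree in which every vertex has degree 3). -/

import Mathlib

/-- A rooted tree given by ordered lists of children, without leaves, in which every descending
chain of only children ends. -/
structure OrderedTree (V : Type*) where
  root : V
  children : V → List V
  parent : V → V
  depth : V → ℕ
  nodup_children : ∀ v, (children v).Nodup
  children_ne_nil : ∀ v, children v ≠ []
  parent_eq : ∀ v, ∀ c ∈ children v, parent c = v
  depth_lt : ∀ v, ∀ c ∈ children v, depth v < depth c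
  root_notMem : ∀ v, root ∉ children v
  mem_children_parent : ∀ v, v ≠ root → v ∈ children (parent v)
  exists_branching : ∀ v, ∃ n, 2 ≤ (children ((fun u ↦ (children u).getD 0 u)^[n] v)).length

namespace OrderedTree

variable {V : Type*} (R : OrderedTree V)

/-- The number of children. -/
def arity (v : V) : ℕ := (R.children v).length

/-- The `i`-th child of `v`, meaningful for `i < R.arity v`. -/
def child (v : V) (i : ℕ) : V := (R.children v).getD i v

open Classical in
/-- The number of steps from `v` down a chain of only children to a branching vertex. -/
noncomputable def chainLength (v : V) : ℕ := Nat.find (R.exists_branching v)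

/-- The first branching vertex on the chain of only children starting at `v`. -/
noncomputable def branch (v : V) : V := (fun u ↦ R.child u 0)^[R.chainLength v] v

/-- The address of the `i`-th of `k` leaves of a binary caterpillar, deepest letter first. -/
def caterpillar (k i : ℕ) : List Bool :=
  if i + 1 < k then false :: List.replicate i true else List.replicate i true

open Classical in
/-- The address in the binary tree of a vertex, deepest letter first. -/
noncomputable def encode (v : V) : List Bool :=
  if _h : v = R.root then [] else
    caterpillar (R.arity (R.parent v)) ((R.children (R.parent v)).idxOf v) ++ encode (R.parent v)
termination_by R.depth v
decreasing_by exact R.depth_lt _ _ (R.mem_children_parent v _h)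

/-- One step down the binary tree. The state `(v, i)` stands for the children of `v` from the
`i`-th on, of which there are at least two. -/
noncomputable def step : Bool → V × ℕ → V × ℕ
  | false, s => (R.branch (R.child s.1 s.2), 0)
  | true, s =>
    if s.2 + 2 < R.arity s.1 then (s.1, s.2 + 1) else (R.branch (R.child s.1 (s.2 + 1)), 0)

/-- The state reached at an address of the binary tree. -/
noncomputable def decode (w : List Bool) : V × ℕ := w.foldr R.step (R.branch R.root, 0)

lemma arity_pos (v : V) : 0 < R.arity v := List.length_pos_iff.2 (R.children_ne_nil v)

lemma child_mem {v : V} {i : ℕ} (hi : i < R.arity v) : R.child v i ∈ R.children v := by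
  unfold child
  rw [List.getD_eq_getElem _ _ hi]
  exact List.getElem_mem hi

lemma exists_eq_child {v : V} (hv : v ≠ R.root) :
    ∃ p i, i < R.arity p ∧ v = R.child p i ∧ R.depth p < R.depth v := by
  have hmem := R.mem_children_parent v hv
  obtain ⟨i, hi, h⟩ := List.getElem_of_mem hmem
  refine ⟨R.parent v, i, hi, ?_, R.depth_lt _ _ hmem⟩
  rw [child, List.getD_eq_getElem _ _ hi, h]

lemma two_le_arity_branch (v : V) : 2 ≤ R.arity (R.branch v) := by
  classical exact Nat.find_spec (R.exists_branching v)

lemma branch_of_two_le {v : V} (h : 2 ≤ R.arity v) : R.branch v = v := by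
  have : R.chainLength v = 0 := by
    classical exact (Nat.find_eq_zero (R.exists_branching v)).2 h
  rw [branch, this, Function.iterate_zero_apply]

lemma chainLength_eq_succ {v : V} (h : R.arity v < 2) :
    R.chainLength v = R.chainLength (R.child v 0) + 1 := by
  classical
  exact Nat.find_comp_succ (R.exists_branching v) (R.exists_branching (R.child v 0)) (not_le.2 h)

lemma branch_child_zero {v : V} (h : R.arity v < 2) : R.branch (R.child v 0) = R.branch v := by
  rw [branch, branch, R.chainLength_eq_succ h, Function.iterate_succ_apply]

lemma encode_root : R.encode R.root = [] := by
  rw [encode, dif_pos rfl]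

lemma encode_child {v : V} {i : ℕ} (hi : i < R.arity v) :
    R.encode (R.child v i) = caterpillar (R.arity v) i ++ R.encode v := by
  have hmem := R.child_mem hi
  have hne : R.child v i ≠ R.root := fun h ↦ R.root_notMem v (h ▸ hmem)
  have hidx : ∀ inst : DecidableEq V, (R.children v).idxOf (R.child v i) = i := by
    intro inst
    unfold child
    rw [List.getD_eq_getElem _ _ hi]
    exact (R.nodup_children v).idxOf_getElem i hi
  rw [encode, dif_neg hne, R.parent_eq v _ hmem, hidx]

lemma encode_branch (v : V) : R.encode (R.branch v) = R.encode v := by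
  induction hn : R.chainLength v generalizing v with
  | zero => rw [branch, hn, Function.iterate_zero_apply]
  | succ n ih =>
    have hv : R.arity v < 2 := by
      by_contra! h
      have : R.chainLength v = 0 := by
        classical exact (Nat.find_eq_zero (R.exists_branching v)).2 h
      omega
    have hlen := R.chainLength_eq_succ hv
    rw [← R.branch_child_zero hv, ih _ (by omega), R.encode_child (R.arity_pos v), caterpillar,
      if_neg (by omega), List.replicate_zero, List.nil_append]

lemma decode_spec (w : List Bool) :
    (R.decode w).2 + 1 < R.arity (R.decode w).1 ∧
      w = List.replicate (R.decode w).2 true ++ R.encode (R.decode w).1 := by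
  induction w with
  | nil =>
    refine ⟨R.two_le_arity_branch _, ?_⟩
    simp [decode, encode_branch, encode_root]
  | cons b w ih =>
    obtain ⟨hlt, heq⟩ := ih
    have hd : R.decode (b :: w) = R.step b (R.decode w) := rfl
    rw [hd]
    generalize R.decode w = s at *
    subst heq
    cases b with
    | false =>
      refine ⟨R.two_le_arity_branch _, ?_⟩
      simp [step, encode_branch, R.encode_child (Nat.lt_of_succ_lt hlt), caterpillar, hlt]
    | true =>
      by_cases h : s.2 + 2 < R.arity s.1
      · simp only [step, if_pos h]
        exact ⟨h, by simp [List.replicate_succ]⟩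
      · simp only [step, if_neg h]
        refine ⟨R.two_le_arity_branch _, ?_⟩
        rw [encode_branch, R.encode_child hlt, caterpillar, if_neg (by omega)]
        simp [List.replicate_succ]

lemma decode_replicate {v : V} {w : List Bool} (hw : R.decode w = (v, 0)) (j : ℕ)
    (hj : j + 1 < R.arity v) : R.decode (List.replicate j true ++ w) = (v, j) := by
  induction j with
  | zero => simpa using hw
  | succ j ih =>
    have : R.decode (List.replicate (j + 1) true ++ w) =
        R.step true (R.decode (List.replicate j true ++ w)) := rfl
    rw [this, ih (by omega), step, if_pos hj]

lemma decode_caterpillar {v : V} {w : List Bool} (hw : R.decode w = (R.branch v, 0)) {i : ℕ}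
    (hi : i < R.arity v) :
    R.decode (caterpillar (R.arity v) i ++ w) = (R.branch (R.child v i), 0) := by
  unfold caterpillar
  by_cases hv : R.arity v < 2
  · obtain rfl : i = 0 := by omega
    rw [if_neg (by omega), R.branch_child_zero hv]
    exact hw
  · rw [R.branch_of_two_le (not_lt.1 hv)] at hw
    split_ifs with h
    · have : R.decode (false :: List.replicate i true ++ w) =
        R.step false (R.decode (List.replicate i true ++ w)) := rfl
      rw [this, R.decode_replicate hw i h, step]
    · obtain ⟨j, rfl⟩ : ∃ j, i = j + 1 := ⟨i - 1, by omega⟩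
      have : R.decode (List.replicate (j + 1) true ++ w) =
        R.step true (R.decode (List.replicate j true ++ w)) := rfl
      rw [this, R.decode_replicate hw j (by omega), step, if_neg (by simpa using h)]

lemma decode_encode (v : V) : R.decode (R.encode v) = (R.branch v, 0) := by
  induction hn : R.depth v using Nat.strong_induction_on generalizing v with
  | _ n ih =>
    by_cases hv : v = R.root
    · rw [hv, encode_root]; rfl
    · obtain ⟨p, i, hi, rfl, hlt⟩ := R.exists_eq_child hv
      rw [R.encode_child hi]
      exact R.decode_caterpillar (ih _ (hn ▸ hlt) p rfl) hi

lemma length_caterpillar_le {k i : ℕ} (hi : i < k) : (caterpillar k i).length ≤ k := by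
  unfold caterpillar
  split_ifs <;> simp <;> omega

end OrderedTree

namespace SimpleGraph

variable {V : Type*} {T : SimpleGraph V}

/-- A map that moves the ends of every edge a bounded distance apart is Lipschitz. -/
lemma Connected.dist_map_le_mul {V' : Type*} {T' : SimpleGraph V'} (hT : T.Connected)
    (hT' : T'.Connected) {f : V → V'} {K : ℕ}
    (hf : ∀ x y, T.Adj x y → T'.dist (f x) (f y) ≤ K) (x y : V) :
    T'.dist (f x) (f y) ≤ K * T.dist x y := by
  obtain ⟨p, hp⟩ := hT.exists_walk_length_eq_dist x y
  rw [← hp]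
  clear hp
  induction p with
  | nil => simp
  | cons h p ih =>
    refine hT'.dist_triangle.trans ((Nat.add_le_add (hf _ _ h) ih).trans ?_)
    rw [Walk.length_cons]
    exact le_of_eq (by ring)

lemma IsTree.eq_of_dist_add_one_eq (hT : T.IsTree) {r v a b : V} (ha : T.Adj v a)
    (hb : T.Adj v b) (hda : T.dist r a + 1 = T.dist r v) (hdb : T.dist r b + 1 = T.dist r v) :
    a = b := by
  obtain ⟨p, hp⟩ := hT.connected.exists_walk_length_eq_dist a r
  obtain ⟨q, hq⟩ := hT.connected.exists_walk_length_eq_dist b r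
  rw [T.dist_comm] at hp hq
  have hpp : (Walk.cons ha p).IsPath := Walk.isPath_of_length_eq_dist _ (by
    rw [Walk.length_cons, hp, hda, T.dist_comm])
  have hqp : (Walk.cons hb q).IsPath := Walk.isPath_of_length_eq_dist _ (by
    rw [Walk.length_cons, hq, hdb, T.dist_comm])
  have := congrArg Walk.snd ((hT.existsUnique_path v r).unique hpp hqp)
  simpa using this

lemma Connected.exists_adj_dist_add_one_eq (hT : T.Connected) {r v : V} (hv : v ≠ r) :
    ∃ u, T.Adj v u ∧ T.dist r u + 1 = T.dist r v := by
  obtain ⟨p, hp⟩ := hT.exists_walk_length_eq_dist v r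
  cases p with
  | nil => exact absurd rfl hv
  | @cons _ u _ h q =>
    refine ⟨u, h, ?_⟩
    have h1 := T.dist_le q
    have h2 := h.symm.diff_dist_adj (u := r)
    rw [Walk.length_cons, T.dist_comm] at hp
    rw [T.dist_comm] at h1
    omega

lemma IsTree.mem_or_eq_of_adj (hT : T.IsTree) (r v : V) :
    ∃ p, ∀ u, T.Adj v u → T.dist r u = T.dist r v + 1 ∨ u = p := by
  by_cases h : ∃ p, T.Adj v p ∧ T.dist r p + 1 = T.dist r v
  · obtain ⟨p, hp, hd⟩ := h
    refine ⟨p, fun u hu ↦ ?_⟩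
    rcases hT.dist_eq_dist_add_one_of_adj r hu with h' | h'
    · exact .inr (hT.eq_of_dist_add_one_eq hu hp h'.symm hd)
    · exact .inl h'
  · refine ⟨v, fun u hu ↦ .inl ?_⟩
    rcases hT.dist_eq_dist_add_one_of_adj r hu with h' | h'
    · exact absurd ⟨u, hu, h'.symm⟩ h
    · exact h'

lemma IsTree.ncard_neighborSet_le (hT : T.IsTree) {r v : V} {l : List V}
    (hl : ∀ u, u ∈ l ↔ T.Adj v u ∧ T.dist r u = T.dist r v + 1) :
    (T.neighborSet v).ncard ≤ l.length + 1 := by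
  classical
  obtain ⟨p, hp⟩ := hT.mem_or_eq_of_adj r v
  have hsub : T.neighborSet v ⊆ ((p :: l).toFinset : Set V) := by
    intro u hu
    have := hp u hu
    have := hl u
    simp only [mem_neighborSet] at hu
    simp
    tauto
  calc (T.neighborSet v).ncard ≤ ((p :: l).toFinset : Set V).ncard :=
        Set.ncard_le_ncard hsub (Finset.finite_toSet _)
    _ = (p :: l).toFinset.card := Set.ncard_coe_finset _
    _ ≤ (p :: l).length := List.toFinset_card_le _
    _ = l.length + 1 := rfl

/-- In a bushy tree a descending chain of only children has bounded length. -/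
lemma IsTree.exists_two_le_length_iterate (hT : T.IsTree) {r : V} {ch : V → List V}
    (hch : ∀ v u, u ∈ ch v ↔ T.Adj v u ∧ T.dist r u = T.dist r v + 1)
    (hne : ∀ v, ch v ≠ []) {B : ℕ}
    (hbushy : ∀ v : V, ∃ w : V, 3 ≤ (T.neighborSet w).ncard ∧ T.dist v w ≤ B) (v : V) :
    ∃ n ≤ 2 * B + 2, 2 ≤ (ch ((fun u ↦ (ch u).getD 0 u)^[n] v)).length := by
  by_contra! hlt
  set x : ℕ → V := fun n ↦ (fun u ↦ (ch u).getD 0 u)^[n] v with hx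
  have hsucc (n : ℕ) : x (n + 1) = (ch (x n)).getD 0 (x n) := Function.iterate_succ_apply' _ _ _
  have hsingle (n : ℕ) (hn : n ≤ 2 * B + 2) : ch (x n) = [x (n + 1)] := by
    obtain ⟨a, ha⟩ : ∃ a, ch (x n) = [a] := by
      rw [← List.length_eq_one_iff]
      have := List.length_pos_iff.2 (hne (x n))
      have : (ch (x n)).length < 2 := hlt n hn
      omega
    rw [hsucc, ha]
    rfl
  have hmem (n : ℕ) (hn : n ≤ 2 * B + 2) (u : V) :
      u = x (n + 1) ↔ T.Adj (x n) u ∧ T.dist r u = T.dist r (x n) + 1 := by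
    rw [← hch, hsingle n hn, List.mem_singleton]
  have hwalk : ∀ {a w : V} (p : T.Walk a w) (j : ℕ), a = x j → p.length < j →
      j + p.length ≤ 2 * B + 2 → ∃ i, i ≤ 2 * B + 2 ∧ w = x i := by
    intro a w p
    induction p with
    | nil => exact fun j ha _ hj ↦ ⟨j, by simpa using hj, ha⟩
    | @cons a b w h p ih =>
      rintro j rfl h1 h2
      rw [Walk.length_cons] at h1 h2
      obtain ⟨k, rfl⟩ : ∃ k, j = k + 1 := ⟨j - 1, by omega⟩
      rcases hT.dist_eq_dist_add_one_of_adj r h with hd | hd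
      · obtain ⟨hadj, hd'⟩ := (hmem k (by omega) _).1 rfl
        exact ih k (hT.eq_of_dist_add_one_eq h hadj.symm hd.symm hd'.symm) (by omega) (by omega)
      · exact ih (k + 2) ((hmem (k + 1) (by omega) b).2 ⟨h, hd⟩) (by omega) (by omega)
  obtain ⟨w, hw, hdw⟩ := hbushy (x (B + 1))
  obtain ⟨p, hp⟩ := hT.connected.exists_walk_length_eq_dist (x (B + 1)) w
  obtain ⟨i, hi, rfl⟩ := hwalk p (B + 1) rfl (by omega) (by omega)
  have := hT.ncard_neighborSet_le (hch (x i))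
  rw [hsingle i hi, List.length_singleton] at this
  omega

/-- A bushy tree of bounded valence without terminal vertices is coarsely equivalent to the
infinite rooted binary tree, whose vertices are the lists of booleans. -/
lemma IsTree.exists_binary_coding [Nonempty V] (hT : T.IsTree) {D B : ℕ}
    (hval : ∀ v : V, (T.neighborSet v).Finite ∧ (T.neighborSet v).ncard ≤ D)
    (hmin : ∀ v : V, 2 ≤ (T.neighborSet v).ncard)
    (hbushy : ∀ v : V, ∃ w : V, 3 ≤ (T.neighborSet w).ncard ∧ T.dist v w ≤ B) :
    ∃ (f : V → List Bool) (g : List Bool → V) (K : ℕ),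
      (∀ x y, T.Adj x y → ∃ l : List Bool, l.length ≤ K ∧ (f x = l ++ f y ∨ f y = l ++ f x)) ∧
      (∀ b w, T.dist (g (b :: w)) (g w) ≤ K) ∧
      (∀ v, T.dist (g (f v)) v ≤ K) ∧
      (∀ w, ∃ l : List Bool, l.length ≤ K ∧ w = l ++ f (g w)) := by
  obtain ⟨r⟩ := ‹Nonempty V›
  have hex (v : V) : ∃ l : List V, l.Nodup ∧
      ∀ u, u ∈ l ↔ T.Adj v u ∧ T.dist r u = T.dist r v + 1 := by
    have hfin : {u | T.Adj v u ∧ T.dist r u = T.dist r v + 1}.Finite :=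
      (hval v).1.subset fun u hu ↦ hu.1
    exact ⟨hfin.toFinset.toList, Finset.nodup_toList _, by simp⟩
  choose ch hnodup hch using hex
  have hne (v : V) : ch v ≠ [] := by
    intro h
    have h1 := hT.ncard_neighborSet_le (hch v)
    have h2 := hmin v
    rw [h, List.length_nil] at h1
    omega
  have hlen (v : V) : (ch v).length ≤ D := by
    classical
    rw [← List.toFinset_card_of_nodup (hnodup v), ← Set.ncard_coe_finset]
    refine (Set.ncard_le_ncard (fun u hu ↦ ?_) (hval v).1).trans (hval v).2
    exact ((hch v u).1 (by simpa using hu)).1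
  have hbranch := hT.exists_two_le_length_iterate hch hne hbushy
  have hpar (v : V) : ∃ p, v ≠ r → T.Adj v p ∧ T.dist r p + 1 = T.dist r v := by
    by_cases hv : v = r
    · exact ⟨v, fun h ↦ absurd hv h⟩
    · obtain ⟨p, hp⟩ := hT.connected.exists_adj_dist_add_one_eq hv
      exact ⟨p, fun _ ↦ hp⟩
  choose par hpar using hpar
  have hroot (v : V) : r ∉ ch v := fun h ↦ by simpa using ((hch v r).1 h).2
  let R : OrderedTree V :=
    { root := r
      children := ch
      parent := par
      depth := T.dist r
      nodup_children := hnodup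
      children_ne_nil := hne
      parent_eq := fun v c hc ↦ by
        obtain ⟨h1, h2⟩ := hpar c (fun h ↦ hroot v (h ▸ hc))
        obtain ⟨h3, h4⟩ := (hch v c).1 hc
        exact hT.eq_of_dist_add_one_eq h1 h3.symm h2 h4.symm
      depth_lt := fun v c hc ↦ by
        rw [((hch v c).1 hc).2]
        exact Nat.lt_succ_self _
      root_notMem := hroot
      mem_children_parent := fun v hv ↦
        (hch _ _).2 ⟨(hpar v hv).1.symm, (hpar v hv).2.symm⟩
      exists_branching := fun v ↦ (hbranch v).imp fun _ h ↦ h.2 }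
  have harity (v : V) : R.arity v ≤ D := hlen v
  have hadj {v : V} {i : ℕ} (hi : i < R.arity v) : T.Adj v (R.child v i) :=
    ((hch _ _).1 (R.child_mem hi)).1
  have hchain (n : ℕ) (v : V) : T.dist ((fun u ↦ R.child u 0)^[n] v) v ≤ n := by
    induction n generalizing v with
    | zero => simp
    | succ n ih =>
      rw [Function.iterate_succ_apply]
      refine hT.connected.dist_triangle.trans (Nat.add_le_add (ih _) (le_of_eq ?_))
      exact dist_eq_one_iff_adj.2 (hadj (R.arity_pos v)).symm
  have hbr (v : V) : T.dist (R.branch v) v ≤ 2 * B + 2 := by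
    obtain ⟨n, hn, h⟩ := hbranch v
    refine (hchain _ v).trans (le_trans ?_ hn)
    classical exact Nat.find_min' (R.exists_branching v) h
  have hbrc {v : V} {i : ℕ} (hi : i < R.arity v) :
      T.dist (R.branch (R.child v i)) v ≤ 2 * B + 3 := by
    refine (hT.connected.dist_triangle (v := R.child v i)).trans ?_
    rw [dist_eq_one_iff_adj.2 (hadj hi).symm]
    exact Nat.succ_le_succ (hbr _)
  have hdown (x y : V) (hy : y ∈ ch x) :
      ∃ l : List Bool, l.length ≤ D + 2 * B + 3 ∧ R.encode y = l ++ R.encode x := by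
    obtain ⟨i, hi, rfl⟩ := List.getElem_of_mem hy
    refine ⟨OrderedTree.caterpillar (R.arity x) i, ?_, ?_⟩
    · have hi' : i < R.arity x := hi
      have := OrderedTree.length_caterpillar_le hi'
      have := harity x
      omega
    · rw [← R.encode_child hi, OrderedTree.child, List.getD_eq_getElem _ _ hi]
  refine ⟨R.encode, fun w ↦ (R.decode w).1, D + 2 * B + 3, ?_, ?_, ?_, ?_⟩
  · intro x y hxy
    rcases hT.dist_eq_dist_add_one_of_adj r hxy with h | h
    · obtain ⟨l, hl, h⟩ := hdown y x ((hch _ _).2 ⟨hxy.symm, h⟩)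
      exact ⟨l, hl, .inl h⟩
    · obtain ⟨l, hl, h⟩ := hdown x y ((hch _ _).2 ⟨hxy, h⟩)
      exact ⟨l, hl, .inr h⟩
  · intro b w
    have hlt := (R.decode_spec w).1
    have hd : R.decode (b :: w) = R.step b (R.decode w) := rfl
    simp only [hd]
    generalize R.decode w = s at *
    cases b with
    | false => exact (hbrc (Nat.lt_of_succ_lt hlt)).trans (by omega)
    | true =>
      by_cases h : s.2 + 2 < R.arity s.1
      · simp [OrderedTree.step, h]
      · simp only [OrderedTree.step, if_neg h]
        exact (hbrc hlt).trans (by omega)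
  · intro v
    simp only [R.decode_encode]
    exact (hbr v).trans (by omega)
  · intro w
    obtain ⟨hlt, heq⟩ := R.decode_spec w
    refine ⟨_, ?_, heq⟩
    have := harity (R.decode w).1
    rw [List.length_replicate]
    omega

lemma Connected.dist_append_le (hT : T.Connected) {g : List Bool → V} {K : ℕ}
    (hg : ∀ b w, T.dist (g (b :: w)) (g w) ≤ K) (l w : List Bool) :
    T.dist (g (l ++ w)) (g w) ≤ l.length * K := by
  induction l with
  | nil => simp
  | cons b l ih =>
    refine hT.dist_triangle.trans ((Nat.add_le_add (hg b (l ++ w)) ih).trans ?_)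
    rw [List.length_cons]
    exact le_of_eq (by ring)

end SimpleGraph

/-- A bounded valence simplicial tree with no terminal vertices (every vertex has
degree at least 2) which is bushy (a vertex of degree ≥ 3 within uniformly bounded
distance of every vertex) is quasi-isometric to the trivalent tree (any tree all of
whose vertices have degree 3). -/
theorem stmt6 {V V' : Type*} [Nonempty V] [Nonempty V']
    (T : SimpleGraph V) (T' : SimpleGraph V')
    (hT : T.IsTree) (hT' : T'.IsTree)
    (D : ℕ) (hval : ∀ v : V, (T.neighborSet v).Finite ∧ (T.neighborSet v).ncard ≤ D)
    (hmin : ∀ v : V, 2 ≤ (T.neighborSet v).ncard)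
    (B : ℕ) (hbushy : ∀ v : V, ∃ w : V, 3 ≤ (T.neighborSet w).ncard ∧ T.dist v w ≤ B)
    (htri : ∀ u : V', (T'.neighborSet u).Finite ∧ (T'.neighborSet u).ncard = 3) :
    ∃ (f : V → V') (lam c : ℝ), 1 ≤ lam ∧ 0 ≤ c ∧
      (∀ x y : V, (T.dist x y : ℝ) / lam - c ≤ (T'.dist (f x) (f y) : ℝ) ∧
        (T'.dist (f x) (f y) : ℝ) ≤ lam * (T.dist x y : ℝ) + c) ∧
      (∀ u : V', ∃ v : V, (T'.dist u (f v) : ℝ) ≤ c) := by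
  have hmin' (u : V') : 2 ≤ (T'.neighborSet u).ncard := by rw [(htri u).2]; norm_num
  have hbushy' (u : V') : ∃ w : V', 3 ≤ (T'.neighborSet w).ncard ∧ T'.dist u w ≤ 0 :=
    ⟨u, (htri u).2.ge, by simp⟩
  obtain ⟨f, g, K, hf, hg, hgf, hfg⟩ := hT.exists_binary_coding hval hmin hbushy
  obtain ⟨f', g', K', hf', hg', hgf', hfg'⟩ :=
    hT'.exists_binary_coding (fun u ↦ ⟨(htri u).1, (htri u).2.le⟩) hmin' hbushy'
  have happ := hT.connected.dist_append_le hg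
  have happ' := hT'.connected.dist_append_le hg'
  have hF (x y : V) : T'.dist (g' (f x)) (g' (f y)) ≤ K * K' * T.dist x y := by
    refine hT.connected.dist_map_le_mul hT'.connected (f := fun v ↦ g' (f v)) ?_ x y
    intro x y hxy
    obtain ⟨l, hl, h | h⟩ := hf x y hxy <;> simp only [h]
    · exact (happ' l _).trans (Nat.mul_le_mul_right _ hl)
    · rw [T'.dist_comm]
      exact (happ' l _).trans (Nat.mul_le_mul_right _ hl)
  have hG (x y : V') : T.dist (g (f' x)) (g (f' y)) ≤ K' * K * T'.dist x y := by
    refine hT'.connected.dist_map_le_mul hT.connected (f := fun v ↦ g (f' v)) ?_ x y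
    intro x y hxy
    obtain ⟨l, hl, h | h⟩ := hf' x y hxy <;> simp only [h]
    · exact (happ l _).trans (Nat.mul_le_mul_right _ hl)
    · rw [T.dist_comm]
      exact (happ l _).trans (Nat.mul_le_mul_right _ hl)
  have hGF (v : V) : T.dist v (g (f' (g' (f v)))) ≤ K + K' * K := by
    obtain ⟨l, hl, h⟩ := hfg' (f v)
    have h1 := happ l (f' (g' (f v)))
    rw [← h] at h1
    have h2 := hgf v
    rw [T.dist_comm] at h2
    exact hT.connected.dist_triangle.trans
      (Nat.add_le_add h2 (h1.trans (Nat.mul_le_mul_right _ hl)))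
  have hFG (u : V') : T'.dist u (g' (f (g (f' u)))) ≤ K' + K * K' := by
    obtain ⟨l, hl, h⟩ := hfg (f' u)
    have h1 := happ' l (f (g (f' u)))
    rw [← h] at h1
    have h2 := hgf' u
    rw [T'.dist_comm] at h2
    exact hT'.connected.dist_triangle.trans
      (Nat.add_le_add h2 (h1.trans (Nat.mul_le_mul_right _ hl)))
  have hlam : (1 : ℝ) ≤ (K : ℝ) * K' + 1 := le_add_of_nonneg_left (by positivity)
  refine ⟨fun v ↦ g' (f v), K * K' + 1, 2 * (K + K' + K * K'), hlam, by positivity,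
    fun x y ↦ ⟨?_, ?_⟩, fun u ↦ ⟨g (f' u), ?_⟩⟩
  · have h : T.dist x y ≤ 2 * (K + K' * K) + K' * K * T'.dist (g' (f x)) (g' (f y)) := by
      have h1 := hT.connected.dist_triangle (u := x) (v := g (f' (g' (f x)))) (w := y)
      have h2 := hT.connected.dist_triangle (u := g (f' (g' (f x))))
        (v := g (f' (g' (f y)))) (w := y)
      have h3 := hGF y
      rw [T.dist_comm] at h3
      have h4 := hGF x
      have h5 := hG (g' (f x)) (g' (f y))
      omega
    have hR : (T.dist x y : ℝ) ≤
        2 * (K + K' * K) + K' * K * T'.dist (g' (f x)) (g' (f y)) := by exact_mod_cast h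
    rw [sub_le_iff_le_add, div_le_iff₀ (by positivity)]
    have hd : (0 : ℝ) ≤ T'.dist (g' (f x)) (g' (f y)) := by positivity
    have hK : (0 : ℝ) ≤ K' := by positivity
    have hc : (0 : ℝ) ≤ 2 * (K + K' + K * K') * (K * K') := by positivity
    linarith
  · have h : (T'.dist (g' (f x)) (g' (f y)) : ℝ) ≤ K * K' * T.dist x y := by
      exact_mod_cast hF x y
    have hd : (0 : ℝ) ≤ T.dist x y := by positivity
    have hc : (0 : ℝ) ≤ 2 * (K + K' + K * K') := by positivity
    linarith
  · have h : (T'.dist u (g' (f (g (f' u)))) : ℝ) ≤ K' + K * K' := by exact_mod_cast hFG u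
    have hK : (0 : ℝ) ≤ K := by positivity
    have hK' : (0 : ℝ) ≤ K' := by positivity
    have hKK' : (0 : ℝ) ≤ K * K' := by positivity
    linarith
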